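/- There exist constants c_1, c_2 > 0 such that for infinitely many n there is a DAG G_n with at most n nodes and an integer R_n with the following properties in the oneshot model: G_n admits a valid pebbling with R_n red pebbles of cost at most c_1·(log n)², while every greedy pebbling of G_n with R_n red pebbles has cost at least c_2·n. In particular, greedy pebblings can be a factor Ω(n / log² n) more costly than the optimum. -/

import Mathlib

namespace RBPebble

open scoped Classical

/-- A pebble is either red (fast memory) or blue (slow memory). -/
inductive Peb : Type
  | red
  | blue
  deriving DecidableEq

/-- The four kinds of moves of a red-blue pebbling. -/
inductive Move (V : Type) : Type
  | toRed (v : V)    -- (1) replace a blue pebble by a red pebble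
  | toBlue (v : V)   -- (2) replace a red pebble by a blue pebble
  | compute (v : V)  -- (3) place a red pebble on a node whose in-neighbors are all red
  | delete (v : V)   -- (4) delete a pebble
  deriving DecidableEq

variable {V : Type}

/-- A configuration assigns to each node no pebble, a red pebble, or a blue pebble. -/
def Config (V : Type) : Type := V → Option Peb

/-- The initial configuration: no pebbles anywhere. -/
def initConfig : Config V := fun _ => none

/-- The effect of a move on a configuration. -/
def applyMove [DecidableEq V] (c : Config V) : Move V → Config V
  | .toRed v => Function.update c v (some Peb.red)
  | .toBlue v => Function.update c v (some Peb.blue)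
  | .compute v => Function.update c v (some Peb.red)
  | .delete v => Function.update c v none

/-- The number of red pebbles in a configuration. -/
noncomputable def redCount [Fintype V] (c : Config V) : ℕ :=
  (Finset.univ.filter fun v => c v = some Peb.red).card

/-- Legality of a move in a given configuration (base model). -/
def legalMove (edge : V → V → Prop) (c : Config V) : Move V → Prop
  | .toRed v => c v = some Peb.blue
  | .toBlue v => c v = some Peb.red
  | .compute v => ∀ u, edge u v → c u = some Peb.red
  | .delete v => c v ≠ none

/-- A sequence of moves is valid from a configuration: every move is legal and
at every point at most `R` red pebbles are on the graph. -/
def ValidFrom [Fintype V] [DecidableEq V] (edge : V → V → Prop) (R : ℕ) :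
    Config V → List (Move V) → Prop
  | _, [] => True
  | c, m :: ms =>
      legalMove edge c m ∧ redCount (applyMove c m) ≤ R ∧
        ValidFrom edge R (applyMove c m) ms

/-- Running a list of moves from a configuration. -/
def runMoves [DecidableEq V] (c : Config V) : List (Move V) → Config V
  | [] => c
  | m :: ms => runMoves (applyMove c m) ms

/-- A sink: a node with no outgoing edge. -/
def IsSink (edge : V → V → Prop) (v : V) : Prop := ∀ u, ¬ edge v u

/-- A source: a node with no incoming edge. -/
def IsSource (edge : V → V → Prop) (v : V) : Prop := ∀ u, ¬ edge u v

/-- A valid pebbling of the DAG with `R` red pebbles: starts from the empty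
configuration, is valid throughout, and in the final configuration every sink
carries a pebble (of either color). -/
def IsPebbling [Fintype V] [DecidableEq V] (edge : V → V → Prop) (R : ℕ)
    (moves : List (Move V)) : Prop :=
  ValidFrom edge R initConfig moves ∧
    ∀ v, IsSink edge v → runMoves initConfig moves v ≠ none

def isTransfer : Move V → Bool
  | .toRed _ => true
  | .toBlue _ => true
  | _ => false

def isCompute : Move V → Bool
  | .compute _ => true
  | _ => false

def isDelete : Move V → Bool
  | .delete _ => true
  | _ => false

/-- The cost of a pebbling: the number of moves of types (1) and (2). -/
def cost (moves : List (Move V)) : ℕ := (moves.filter isTransfer).length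

/-- The number of compute moves (type (3)). -/
def computeCount (moves : List (Move V)) : ℕ := (moves.filter isCompute).length

/-- The number of delete moves (type (4)). -/
def deleteCount (moves : List (Move V)) : ℕ := (moves.filter isDelete).length

/-- The cost in the compcost model: transfers plus `ε` times the computes. -/
noncomputable def ccCost (ε : ℝ) (moves : List (Move V)) : ℝ :=
  (cost moves : ℝ) + ε * (computeCount moves : ℝ)

/-- The oneshot restriction: each node is computed at most once. -/
def Oneshot [DecidableEq V] (moves : List (Move V)) : Prop :=
  ∀ v : V, moves.count (Move.compute v) ≤ 1

/-- The nodel restriction: no delete moves are used. -/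
def NoDel (moves : List (Move V)) : Prop := ∀ m ∈ moves, isDelete m = false

/-- The indegree of a node. -/
noncomputable def indeg [Fintype V] (edge : V → V → Prop) (v : V) : ℕ :=
  (Finset.univ.filter fun u => edge u v).card

/-- The edge relation is acyclic (the graph is a DAG). -/
def Acyclic (edge : V → V → Prop) : Prop :=
  ∀ v, ¬ Relation.TransGen edge v v

/-- The optimal cost of a valid pebbling with `R` red pebbles in the oneshot model. -/
noncomputable def optCost [Fintype V] [DecidableEq V] (edge : V → V → Prop) (R : ℕ) : ℕ :=
  sInf {c | ∃ moves : List (Move V),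
    IsPebbling edge R moves ∧ Oneshot moves ∧ cost moves = c}

/-- A node counts as computed in a prefix of moves if a compute move was
applied to it there. -/
def computedIn {V : Type} (l : List (Move V)) (w : V) : Prop :=
  Move.compute w ∈ l

/-- The number of in-neighbors of `w` currently carrying red pebbles. -/
noncomputable def redInNbrs {V : Type} [Fintype V] (edge : V → V → Prop)
    (c : Config V) (w : V) : ℕ :=
  (Finset.univ.filter fun u => edge u w ∧ c u = some Peb.red).card

/-- A pebbling (in the oneshot model) is greedy if every compute move is
applied to a node that, among all yet-uncomputed nodes all of whose
in-neighbors have already been computed, has the maximum number of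
in-neighbors currently carrying red pebbles. -/
def GreedyPebbling {V : Type} [Fintype V] [DecidableEq V]
    (edge : V → V → Prop) (moves : List (Move V)) : Prop :=
  ∀ l₁ (v : V) l₂, moves = l₁ ++ Move.compute v :: l₂ →
    ∀ w : V, ¬ computedIn l₁ w → (∀ u, edge u w → computedIn l₁ u) →
      redInNbrs edge (runMoves initConfig l₁) w ≤
        redInNbrs edge (runMoves initConfig l₁) v

section General

theorem applyMove_toRed_apply [DecidableEq V] (c : Config V) (v w : V) :
    applyMove c (.toRed v) w = if w = v then some Peb.red else c w :=
  Function.update_apply ..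

theorem applyMove_toBlue_apply [DecidableEq V] (c : Config V) (v w : V) :
    applyMove c (.toBlue v) w = if w = v then some Peb.blue else c w :=
  Function.update_apply ..

theorem applyMove_compute_apply [DecidableEq V] (c : Config V) (v w : V) :
    applyMove c (.compute v) w = if w = v then some Peb.red else c w :=
  Function.update_apply ..

theorem applyMove_delete_apply [DecidableEq V] (c : Config V) (v w : V) :
    applyMove c (.delete v) w = if w = v then none else c w :=
  Function.update_apply ..

theorem runMoves_append [DecidableEq V] (c : Config V) (l₁ l₂ : List (Move V)) :
    runMoves c (l₁ ++ l₂) = runMoves (runMoves c l₁) l₂ := by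
  induction l₁ generalizing c with
  | nil => rfl
  | cons m ms ih => exact ih _

theorem validFrom_append [Fintype V] [DecidableEq V] (edge : V → V → Prop) (R : ℕ)
    (c : Config V) (l₁ l₂ : List (Move V)) :
    ValidFrom edge R c (l₁ ++ l₂) ↔
      ValidFrom edge R c l₁ ∧ ValidFrom edge R (runMoves c l₁) l₂ := by
  induction l₁ generalizing c with
  | nil => simp [ValidFrom, runMoves]
  | cons m ms ih => simp [ValidFrom, runMoves, ih, and_assoc]

theorem cost_append (l₁ l₂ : List (Move V)) : cost (l₁ ++ l₂) = cost l₁ + cost l₂ := by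
  simp [cost]

/-- An empty node that is not computed any more stays empty. -/
theorem runMoves_eq_none [Fintype V] [DecidableEq V] {edge : V → V → Prop} {R : ℕ}
    {c : Config V} {l : List (Move V)} (hl : ValidFrom edge R c l) {v : V}
    (hv : c v = none) (hc : Move.compute v ∉ l) : runMoves c l v = none := by
  induction l generalizing c with
  | nil => exact hv
  | cons m ms ih =>
    obtain ⟨hm, -, hms⟩ := hl
    simp only [List.mem_cons, not_or] at hc
    refine ih hms ?_ hc.2
    cases m <;> simp only [applyMove_toRed_apply, applyMove_toBlue_apply, applyMove_compute_apply,
        applyMove_delete_apply, legalMove] at hm ⊢ <;>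
      split_ifs with h <;> simp_all

/-- Every in-neighbor of a node is computed before that node. -/
theorem computedIn_of_edge [Fintype V] [DecidableEq V] {edge : V → V → Prop} {R : ℕ}
    {l₁ l₂ : List (Move V)} {u w : V}
    (hl : ValidFrom edge R initConfig (l₁ ++ Move.compute w :: l₂)) (huw : edge u w) :
    computedIn l₁ u := by
  by_contra hu
  rw [validFrom_append] at hl
  have h := hl.2.1 u huw
  rw [runMoves_eq_none hl.1 rfl hu] at h
  cases h

theorem computedIn_of_computedIn [Fintype V] [DecidableEq V] {edge : V → V → Prop} {R : ℕ}
    {l : List (Move V)} {u w : V} (hl : ValidFrom edge R initConfig l)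
    (hw : computedIn l w) (huw : edge u w) : computedIn l u := by
  obtain ⟨a, b, rfl⟩ := List.append_of_mem hw
  exact List.mem_append_left _ (computedIn_of_edge hl huw)

/-- In the oneshot model, a computed node carries a pebble as long as one of its
out-neighbors is still to be computed. -/
theorem runMoves_ne_none_of_needed [Fintype V] [DecidableEq V] {edge : V → V → Prop} {R : ℕ}
    {l₁ l₂ : List (Move V)} {u w : V} (hl : ValidFrom edge R initConfig (l₁ ++ l₂))
    (hone : Oneshot (l₁ ++ l₂)) (hu : computedIn l₁ u) (hw : computedIn l₂ w)
    (huw : edge u w) : runMoves initConfig l₁ u ≠ none := by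
  intro hnone
  have hu₂ : Move.compute u ∉ l₂ := by
    intro h
    have h₁ := List.count_pos_iff.2 hu
    have h₂ := List.count_pos_iff.2 h
    have h₃ := hone u
    rw [List.count_append] at h₃
    omega
  obtain ⟨a, b, rfl⟩ := List.append_of_mem hw
  rw [validFrom_append, validFrom_append] at hl
  have h := hl.2.2.1 u huw
  rw [runMoves_eq_none hl.2.1 hnone fun h => hu₂ (List.mem_append_left _ h)] at h
  cases h

/-- The number of blue pebbles grows by at most the cost of the moves. -/
theorem card_blue_runMoves_le [Fintype V] [DecidableEq V] (c : Config V) (l : List (Move V)) :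
    (Finset.univ.filter fun v => runMoves c l v = some Peb.blue).card ≤
      (Finset.univ.filter fun v => c v = some Peb.blue).card + cost l := by
  induction l generalizing c with
  | nil => exact le_add_right le_rfl
  | cons m ms ih =>
    have hcost : cost (m :: ms) = cost [m] + cost ms := cost_append [m] ms
    suffices h : (Finset.univ.filter fun v => applyMove c m v = some Peb.blue).card ≤
        (Finset.univ.filter fun v => c v = some Peb.blue).card + cost [m] by
      refine (ih (applyMove c m)).trans ?_
      omega
    have hsub (v : V) (hm : m ≠ Move.toBlue v) (hv : applyMove c m v = some Peb.blue) :
        c v = some Peb.blue := by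
      cases m <;> simp only [applyMove_toRed_apply, applyMove_toBlue_apply, applyMove_compute_apply,
        applyMove_delete_apply] at hv <;>
        split_ifs at hv <;> simp_all
    by_cases hm : ∃ v, m = Move.toBlue v
    · obtain ⟨v, rfl⟩ := hm
      have : cost [Move.toBlue v] = 1 := rfl
      rw [this]
      refine (Finset.card_le_card (t := insert v _) fun w hw => ?_).trans
        (Finset.card_insert_le v _)
      by_cases hwv : w = v
      · simp [hwv]
      · simp only [Finset.mem_insert, Finset.mem_filter, Finset.mem_univ, true_and] at hw ⊢
        exact Or.inr (hsub w (by simpa using Ne.symm hwv) hw)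
    · push Not at hm
      refine le_add_right (Finset.card_le_card fun w hw => ?_)
      simp only [Finset.mem_filter, Finset.mem_univ, true_and] at hw ⊢
      exact hsub w (hm w) hw

/-- A set of pebbled nodes has at most as many elements as it has red pebbles, plus the cost
spent so far. -/
theorem card_le_red_add_cost [Fintype V] [DecidableEq V] (l : List (Move V)) (S : Finset V)
    (hS : ∀ v ∈ S, runMoves initConfig l v ≠ none) :
    S.card ≤ (S.filter fun v => runMoves initConfig l v = some Peb.red).card + cost l := by
  have hblue := card_blue_runMoves_le (initConfig (V := V)) l
  have h₀ : (Finset.univ.filter fun v : V => initConfig v = some Peb.blue).card = 0 := by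
    simp [initConfig]
  have hle : (S.filter fun v => ¬ runMoves initConfig l v = some Peb.red).card ≤
      (Finset.univ.filter fun v => runMoves initConfig l v = some Peb.blue).card := by
    refine Finset.card_le_card fun v hv => ?_
    simp only [Finset.mem_filter, Finset.mem_univ, true_and] at hv ⊢
    have := hS v hv.1
    match h : runMoves initConfig l v with
    | none => exact absurd h this
    | some Peb.red => exact absurd h hv.2
    | some Peb.blue => rfl
  have := Finset.card_filter_add_card_filter_not (s := S)
    (fun v => runMoves initConfig l v = some Peb.red)
  omega

theorem redCount_runMoves_le [Fintype V] [DecidableEq V] {edge : V → V → Prop} {R : ℕ}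
    {c : Config V} {l : List (Move V)} (hc : redCount c ≤ R) (hl : ValidFrom edge R c l) :
    redCount (runMoves c l) ≤ R := by
  induction l generalizing c with
  | nil => exact hc
  | cons m ms ih => exact ih hl.2.1 hl.2.2

end General

section Trap

/-- The trap graph with `d` roots. The nodes `0, …, d - 1` are the roots, and node `d` is a hub
with the roots as inputs. The nodes `d + 1, d + 3, …` form a spine: the first one has the hub as
its only input, and node `d + 3 + 2 * i` has the inputs `d + 1 + 2 * i` and `d + 2 + 2 * i`. The
nodes `d + 2, d + 4, …` are ribs, whose inputs are the roots. -/
def trapEdge (d : ℕ) {m : ℕ} (u v : Fin m) : Prop :=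
  (u.val < d ∧ v.val = d) ∨ (u.val = d ∧ v.val = d + 1) ∨
    (u.val < d ∧ ∃ i, v.val = d + 2 + 2 * i) ∨
    ∃ i, v.val = d + 3 + 2 * i ∧ (u.val = d + 2 + 2 * i ∨ u.val = d + 1 + 2 * i)

variable {d m : ℕ}

theorem lt_of_trapEdge {u v : Fin m} (h : trapEdge d u v) : u < v := by
  rw [Fin.lt_def]
  rcases h with h | h | ⟨h, i, hi⟩ | ⟨i, hi, h⟩ <;> omega

theorem acyclic_trapEdge : Acyclic (trapEdge d (m := m)) := by
  intro v hv
  have h : ∀ u w : Fin m, Relation.TransGen (trapEdge d) u w → u < w := by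
    intro u w huw
    induction huw with
    | single h => exact lt_of_trapEdge h
    | tail _ h ih => exact ih.trans (lt_of_trapEdge h)
  exact lt_irrefl v (h v v hv)

/-- The configuration with red pebbles on the nodes satisfying `p`, and no other pebbles. -/
noncomputable def redOn (p : ℕ → Prop) : Config (Fin m) :=
  fun v => if p v.val then some Peb.red else none

theorem redOn_eq_red {p : ℕ → Prop} {v : Fin m} : redOn p v = some Peb.red ↔ p v.val := by
  simp [redOn]

theorem applyMove_compute_redOn (p : ℕ → Prop) (v : Fin m) :
    applyMove (redOn p) (Move.compute v) = redOn fun x => p x ∨ x = v.val := by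
  funext w
  by_cases h : w = v
  · simp [applyMove_compute_apply, redOn, h]
  · simp [applyMove_compute_apply, redOn, h, Fin.val_inj]

theorem applyMove_delete_redOn (p : ℕ → Prop) (v : Fin m) :
    applyMove (redOn p) (Move.delete v) = redOn fun x => p x ∧ x ≠ v.val := by
  funext w
  by_cases h : w = v
  · simp [applyMove_delete_apply, redOn, h]
  · simp [applyMove_delete_apply, redOn, h, Fin.val_inj]

theorem redCount_redOn_le {p : ℕ → Prop} (e : ℕ)
    (hp : ∀ x, p x → x < d + 1 ∨ (e ≤ x ∧ x < e + 3)) :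
    redCount (redOn p : Config (Fin m)) ≤ d + 4 := by
  have h : redCount (redOn p : Config (Fin m)) ≤
      (Finset.range (d + 1) ∪ Finset.Ico e (e + 3)).card := by
    refine Finset.card_le_card_of_injOn Fin.val (fun v hv => ?_) Fin.val_injective.injOn
    have := hp v.val (redOn_eq_red.1 (by simpa using hv))
    simpa using this
  refine h.trans ((Finset.card_union_le _ _).trans ?_)
  simp

/-- Without transfers, the nodes of the trap graph up to the first one of the spine can be
computed in increasing order. -/
theorem exists_moves_base (j : ℕ) (hj : j ≤ d + 2) (hjm : j ≤ m) :
    ∃ l : List (Move (Fin m)), ValidFrom (trapEdge d) (d + 4) initConfig l ∧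
      runMoves initConfig l = redOn (fun x => x < j) ∧ cost l = 0 ∧
      (∀ v, l.count (Move.compute v) ≤ 1) ∧ ∀ v, Move.compute v ∈ l → v.val < j := by
  induction j with
  | zero =>
    refine ⟨[], trivial, ?_, rfl, by simp, by simp⟩
    funext v
    simp [runMoves, redOn, initConfig]
  | succ j ih =>
    obtain ⟨l, hv, hr, hc, hone, hlt⟩ := ih (by omega) (by omega)
    have hrun : applyMove (redOn (m := m) (fun x => x < j)) (Move.compute ⟨j, by omega⟩) =
        redOn (fun x => x < j + 1) := by
      rw [applyMove_compute_redOn]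
      congr 1
      funext x
      simp only [eq_iff_iff]
      omega
    refine ⟨l ++ [Move.compute ⟨j, by omega⟩], ?_, ?_, ?_, ?_, ?_⟩
    · rw [validFrom_append, hr]
      refine ⟨hv, fun u hu => redOn_eq_red.2 (lt_of_trapEdge hu), ?_, trivial⟩
      rw [hrun]
      exact redCount_redOn_le (d + 1) fun x hx => by omega
    · rw [runMoves_append, hr]
      exact hrun
    · rw [cost_append, hc]
      rfl
    · intro v
      have h₁ := hone v
      by_cases hvj : v.val = j
      · have : Move.compute v ∉ l := fun h => by have := hlt v h; omega
        rw [List.count_append, List.count_eq_zero.2 this, zero_add]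
        exact List.count_le_length
      · have : Move.compute v ∉ [Move.compute (⟨j, by omega⟩ : Fin m)] := by
          simpa [Fin.ext_iff] using hvj
        rw [List.count_append, List.count_eq_zero.2 this]
        exact h₁
    · intro v hvl
      simp only [List.mem_append, List.mem_singleton, Move.compute.injEq, Fin.ext_iff] at hvl
      rcases hvl with h | h
      · exact (hlt v h).trans (by omega)
      · omega

/-- Without transfers, the spine of the trap graph can be climbed one node at a time. -/
theorem exists_moves_spine (i : ℕ) (hi : d + 2 + 2 * i ≤ m) :
    ∃ l : List (Move (Fin m)), ValidFrom (trapEdge d) (d + 4) initConfig l ∧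
      runMoves initConfig l = redOn (fun x => x < d + 1 ∨ x = d + 1 + 2 * i) ∧ cost l = 0 ∧
      (∀ v, l.count (Move.compute v) ≤ 1) ∧
      ∀ v, Move.compute v ∈ l → v.val < d + 2 + 2 * i := by
  induction i with
  | zero =>
    obtain ⟨l, hv, hr, hrest⟩ := exists_moves_base (d := d) (m := m) (d + 2) le_rfl hi
    refine ⟨l, hv, ?_, hrest⟩
    rw [hr]
    congr 1
    funext x
    simp only [eq_iff_iff]
    omega
  | succ i ih =>
    obtain ⟨l, hv, hr, hc, hone, hlt⟩ := ih (by omega)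
    set rib : Fin m := ⟨d + 2 + 2 * i, by omega⟩ with hrib
    set old : Fin m := ⟨d + 1 + 2 * i, by omega⟩ with hold
    set new : Fin m := ⟨d + 3 + 2 * i, by omega⟩ with hnew
    refine ⟨l ++ [.compute rib, .compute new, .delete rib, .delete old], ?_, ?_, ?_, ?_, ?_⟩
    · rw [validFrom_append, hr]
      refine ⟨hv, ?_⟩
      simp only [ValidFrom, applyMove_compute_redOn, applyMove_delete_redOn, and_true]
      refine ⟨fun u hu => redOn_eq_red.2 ?_, redCount_redOn_le (d + 1 + 2 * i) ?_,
        fun u hu => redOn_eq_red.2 ?_, redCount_redOn_le (d + 1 + 2 * i) ?_, ?_,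
        redCount_redOn_le (d + 1 + 2 * i) ?_, ?_, redCount_redOn_le (d + 1 + 2 * i) ?_⟩
      · rcases hu with h | h | ⟨h, j, hj⟩ | ⟨j, hj, h⟩ <;> simp only [hrib] at * <;> omega
      · simp only [hrib]; omega
      · rcases hu with h | h | ⟨h, j, hj⟩ | ⟨j, hj, h⟩ <;> simp only [hrib, hnew] at * <;> omega
      · simp only [hrib, hnew]; omega
      · simp [legalMove, redOn]
      · simp only [hrib, hnew]; omega
      · simp [legalMove, redOn, hrib, hold]
      · simp only [hrib, hnew, hold]; omega
    · rw [runMoves_append, hr]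
      simp only [runMoves, applyMove_compute_redOn, applyMove_delete_redOn]
      congr 1
      funext x
      simp only [eq_iff_iff, hrib, hnew, hold]
      omega
    · rw [cost_append, hc]
      rfl
    · intro v
      have h₁ := hone v
      have hne : rib ≠ new := by simp [hrib, hnew]
      by_cases hvl : Move.compute v ∈ l
      · have hvlt := hlt v hvl
        have h₂ : rib ≠ v := by
          rintro rfl
          simp only [hrib] at hvlt
          omega
        have h₃ : new ≠ v := by
          rintro rfl
          simp only [hnew] at hvlt
          omega
        simpa [List.count_cons, h₂, h₃] using h₁
      · rw [List.count_append, List.count_eq_zero.2 hvl]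
        by_cases h₂ : rib = v
        · subst h₂
          simp [hne.symm]
        · simp only [List.count_cons, beq_iff_eq, Move.compute.injEq, h₂]
          split_ifs <;> simp_all
    · intro v hvl
      simp only [List.mem_append, List.mem_cons, Move.compute.injEq, List.not_mem_nil,
        reduceCtorEq, or_false] at hvl
      rcases hvl with h | rfl | rfl
      · exact (hlt v h).trans (by omega)
      · simp only [hrib]; omega
      · simp only [hnew]; omega

theorem exists_free_pebbling (d k : ℕ) :
    ∃ l : List (Move (Fin (d + 2 + 2 * k))),
      IsPebbling (trapEdge d) (d + 4) l ∧ Oneshot l ∧ cost l = 0 := by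
  obtain ⟨l, hv, hr, hc, hone, -⟩ := exists_moves_spine (d := d) (m := d + 2 + 2 * k) k le_rfl
  refine ⟨l, ⟨hv, fun v hsink => ?_⟩, hone, hc⟩
  rw [hr]
  by_contra hnone
  have hnot : ¬ (v.val < d + 1 ∨ v.val = d + 1 + 2 * k) := fun h => by
    rw [redOn_eq_red.2 h] at hnone
    cases hnone
  have hvm := v.isLt
  obtain ⟨i, hi⟩ | ⟨i, hi⟩ : (∃ i, v.val = d + 2 + 2 * i) ∨ ∃ i, v.val = d + 1 + 2 * i := by
    rcases Nat.even_or_odd' (v.val - (d + 1)) with ⟨i, hi | hi⟩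
    · exact Or.inr ⟨i, by omega⟩
    · exact Or.inl ⟨i, by omega⟩
  all_goals
    refine hsink ⟨d + 3 + 2 * i, by omega⟩ (Or.inr (Or.inr (Or.inr ⟨i, rfl, ?_⟩)))
    omega

/-- Every greedy pebbling of the trap graph is expensive: it either moves all roots but one to slow
memory before entering the spine, or it computes all ribs before that. -/
theorem le_cost_of_greedy (d k : ℕ) (hk : 2 * d + 4 ≤ k)
    {moves : List (Move (Fin (d + 2 + 2 * k)))} (hpeb : IsPebbling (trapEdge d) (d + 4) moves)
    (hone : Oneshot moves) (hgreedy : GreedyPebbling (trapEdge d) moves) :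
    d ≤ cost moves + 1 := by
  obtain ⟨hvalid, hsinks⟩ := hpeb
  let spine (i : ℕ) (hi : i ≤ k) : Fin (d + 2 + 2 * k) := ⟨d + 1 + 2 * i, by omega⟩
  let rib (i : Fin k) : Fin (d + 2 + 2 * k) := ⟨d + 2 + 2 * i, by omega⟩
  let root (i : Fin d) : Fin (d + 2 + 2 * k) := ⟨i, by omega⟩
  let hub : Fin (d + 2 + 2 * k) := ⟨d, by omega⟩
  have root_hub (i) : trapEdge d (root i) hub := Or.inl ⟨i.isLt, rfl⟩
  have hub_spine : trapEdge d hub (spine 0 (by omega)) := Or.inr (Or.inl ⟨rfl, rfl⟩)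
  have root_rib (i j) : trapEdge d (root i) (rib j) :=
    Or.inr (Or.inr (Or.inl ⟨i.isLt, j, rfl⟩))
  have rib_spine (i : Fin k) : trapEdge d (rib i) (spine (i + 1) i.isLt) :=
    Or.inr (Or.inr (Or.inr ⟨i, by simp only [spine]; omega, Or.inl rfl⟩))
  have spine_spine (i) (hi : i + 1 ≤ k) :
      trapEdge d (spine i (by omega)) (spine (i + 1) hi) :=
    Or.inr (Or.inr (Or.inr ⟨i, by simp only [spine]; omega, Or.inr rfl⟩))
  have hlast : computedIn moves (spine k le_rfl) := by
    by_contra h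
    refine hsinks _ (fun u hu => ?_) (runMoves_eq_none hvalid rfl h)
    have := Fin.lt_def.1 (lt_of_trapEdge hu)
    have := u.isLt
    simp only [spine] at *
    omega
  have hspine : ∀ i (hi : i ≤ k), computedIn moves (spine i hi) := fun i hi =>
    Nat.decreasingInduction' (P := fun j => ∀ hj : j ≤ k, computedIn moves (spine j hj))
      (fun j hj _ ih _ => computedIn_of_computedIn hvalid (ih hj) (spine_spine j hj))
      hi (fun _ => hlast) hi
  have hribs (i : Fin k) : computedIn moves (rib i) :=
    computedIn_of_computedIn hvalid (hspine _ i.isLt) (rib_spine i)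
  obtain ⟨l₁, l₂, rfl⟩ := List.append_of_mem (hspine 0 (by omega))
  set first := spine 0 (by omega)
  have hvalid₁ := ((validFrom_append _ _ _ _ _).1 hvalid).1
  have hhub : computedIn l₁ hub := computedIn_of_edge hvalid hub_spine
  have hroot (i) : computedIn l₁ (root i) :=
    computedIn_of_computedIn hvalid₁ hhub (root_hub i)
  have hfirst : ¬ computedIn l₁ first := by
    intro h
    have h₁ := List.count_pos_iff.2 h
    have h₂ := hone first
    rw [List.count_append, List.count_cons_self] at h₂
    omega
  have hspine₁ : ∀ i (hi : i ≤ k), ¬ computedIn l₁ (spine i hi) := by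
    intro i
    induction i with
    | zero => exact fun _ => hfirst
    | succ i ih =>
      exact fun hi h => ih (by omega) (computedIn_of_computedIn hvalid₁ h (spine_spine i hi))
  have hcost : cost l₁ ≤ cost (l₁ ++ Move.compute first :: l₂) := by
    rw [cost_append]
    omega
  by_cases hall : ∀ i, computedIn l₁ (rib i)
  · have hinj : Function.Injective rib := fun i j h => by
      simp only [rib, Fin.mk.injEq] at h
      omega
    have h := card_le_red_add_cost l₁ (Finset.univ.image rib) (by
      simp only [Finset.mem_image, Finset.mem_univ, true_and, forall_exists_index,
        forall_apply_eq_imp_iff]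
      exact fun i => runMoves_ne_none_of_needed hvalid hone (hall i)
        ((List.mem_append.1 (hspine _ i.isLt)).resolve_left (hspine₁ _ i.isLt)) (rib_spine i))
    have hred := redCount_runMoves_le (by simp [redCount, initConfig]) hvalid₁
    have hle := Finset.card_le_card (Finset.filter_subset_filter
      (fun v => runMoves initConfig l₁ v = some Peb.red)
      (Finset.subset_univ (Finset.univ.image rib)))
    rw [Finset.card_image_of_injective _ hinj, Finset.card_univ, Fintype.card_fin] at h
    simp only [redCount] at hred
    omega
  · push Not at hall
    obtain ⟨j, hj⟩ := hall
    have hinj : Function.Injective root := fun i j h => by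
      simp only [root, Fin.mk.injEq] at h
      omega
    have h := card_le_red_add_cost l₁ (Finset.univ.image root) (by
      simp only [Finset.mem_image, Finset.mem_univ, true_and, forall_exists_index,
        forall_apply_eq_imp_iff]
      exact fun i => runMoves_ne_none_of_needed hvalid hone (hroot i)
        ((List.mem_append.1 (hribs j)).resolve_left hj) (root_rib i j))
    rw [Finset.card_image_of_injective _ hinj, Finset.card_univ, Fintype.card_fin] at h
    have hg := hgreedy l₁ first l₂ rfl (rib j) hj (by
      intro u hu
      have hud : u.val < d := by
        have hval : (rib j).val = d + 2 + 2 * j := rfl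
        rcases hu with h | h | ⟨h, -⟩ | ⟨i, h, -⟩ <;> omega
      exact hroot ⟨u, hud⟩)
    have hone_in : redInNbrs (trapEdge d) (runMoves initConfig l₁) first ≤ 1 := by
      refine Finset.card_le_one_iff_subset_singleton.2 ⟨hub, fun u hu => ?_⟩
      simp only [Finset.mem_filter, Finset.mem_univ, true_and] at hu
      rw [Finset.mem_singleton, Fin.ext_iff]
      rcases hu.1 with h | h | ⟨h, i, hi⟩ | ⟨i, hi, h⟩ <;>
        simp only [first, spine, hub] at * <;> omega
    have hle : ((Finset.univ.image root).filter
        fun v => runMoves initConfig l₁ v = some Peb.red).card ≤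
        redInNbrs (trapEdge d) (runMoves initConfig l₁) (rib j) := by
      refine Finset.card_le_card fun u hu => ?_
      simp only [Finset.mem_filter, Finset.mem_image, Finset.mem_univ, true_and] at hu ⊢
      obtain ⟨⟨i, rfl⟩, hred⟩ := hu
      exact ⟨root_rib i j, hred⟩
    omega

end Trap

/-- There are constants `c₁, c₂ > 0` such that for infinitely
many `n` there is a DAG with at most `n` nodes and a pebble number `R` for
which, in the oneshot model, some valid pebbling has cost at most
`c₁·(log n)²` while every greedy valid pebbling has cost at least `c₂·n`. -/
theorem greedy_pebbling_not_approximation :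
    ∃ c₁ c₂ : ℝ, 0 < c₁ ∧ 0 < c₂ ∧
      ∀ n₀ : ℕ, ∃ n : ℕ, n₀ ≤ n ∧
        ∃ (m : ℕ) (edge : Fin m → Fin m → Prop) (R : ℕ),
          Acyclic edge ∧ m ≤ n ∧
          (∃ moves : List (Move (Fin m)),
            IsPebbling edge R moves ∧ Oneshot moves ∧
              (cost moves : ℝ) ≤ c₁ * (Real.log n) ^ 2) ∧
          (∀ moves : List (Move (Fin m)),
            IsPebbling edge R moves → Oneshot moves →
              GreedyPebbling edge moves →
                c₂ * (n : ℝ) ≤ (cost moves : ℝ)) := by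
  refine ⟨1, 1 / 20, one_pos, by norm_num, fun n₀ => ?_⟩
  let d := n₀ + 2
  let k := 2 * d + 4
  refine ⟨d + 2 + 2 * k, by omega, d + 2 + 2 * k, trapEdge d, d + 4, acyclic_trapEdge, le_rfl,
    ?_, fun moves hpeb hone hgreedy => ?_⟩
  · obtain ⟨l, hpeb, hone, hcost⟩ := exists_free_pebbling d k
    refine ⟨l, hpeb, hone, ?_⟩
    rw [hcost, Nat.cast_zero]
    positivity
  · have h := le_cost_of_greedy d k le_rfl hpeb hone hgreedy
    have h' : d + 2 + 2 * k ≤ 20 * cost moves := by omega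
    have h'' : ((d + 2 + 2 * k : ℕ) : ℝ) ≤ 20 * (cost moves : ℝ) := by exact_mod_cast h'
    linarith

end RBPebble
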